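/- For every λ ∈ (0,1) and every μ > 1, there exist a constant C > 1 and an infinitely differentiable function β : ℝ → ℝ such that: β is odd; the fixed points of β are exactly −1, 0, and +1 (that is, β(s) = s if and only if s ∈ {−1, 0, 1}); the derivative of β at 0 satisfies 1 < β'(0) < μ; the derivatives at the other fixed points satisfy β'(−1) = β'(1) = λ; and β(s) = λ·s for all s ∈ ℝ with |s| > C. -/

import Mathlib

/-- for every `λ ∈ (0,1)` and `μ > 1` there exist `C > 1` and a
`C^∞` function `β : ℝ → ℝ` which is odd, whose fixed points are exactly
`-1`, `0`, `+1`, with `1 < β'(0) < μ`, `β'(-1) = β'(1) = λ`, and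
`β(s) = λ·s` whenever `|s| > C`. -/
theorem stmt_16 (l μ : ℝ) (hl0 : 0 < l) (hl1 : l < 1) (hμ : 1 < μ) :
    ∃ C : ℝ, 1 < C ∧ ∃ β : ℝ → ℝ,
      ContDiff ℝ (⊤ : ℕ∞) β ∧
      (∀ s : ℝ, β (-s) = -β s) ∧
      (∀ s : ℝ, β s = s ↔ s = -1 ∨ s = 0 ∨ s = 1) ∧
      1 < deriv β 0 ∧ deriv β 0 < μ ∧
      deriv β (-1) = l ∧ deriv β 1 = l ∧
      (∀ s : ℝ, C < |s| → β s = l * s) := by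
  obtain ⟨a, ha0, hak, haμ⟩ : ∃ a : ℝ, 0 < a ∧ a ≤ (1 - l) / 2 ∧ a < μ - 1 :=
    ⟨min ((1 - l) / 2) ((μ - 1) / 2), lt_min (by linarith) (by linarith), min_le_left _ _,
      lt_of_le_of_lt (min_le_right _ _) (by linarith)⟩
  obtain ⟨b, hb⟩ : ∃ b : ℝ, b = (1 - l) / 2 - a := ⟨_, rfl⟩
  have hb0 : 0 ≤ b := by linarith
  let β : ℝ → ℝ := fun s => s * (1 + (Real.smoothTransition (s ^ 2 - 2) * (-(1 - l)) +
    (1 - Real.smoothTransition (s ^ 2 - 2)) * ((1 - s ^ 2) * (a + b * s ^ 2))))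
  have hβ : ∀ s, β s = s * (1 + (Real.smoothTransition (s ^ 2 - 2) * (-(1 - l)) +
    (1 - Real.smoothTransition (s ^ 2 - 2)) * ((1 - s ^ 2) * (a + b * s ^ 2)))) := fun _ => rfl
  have hlow : ∀ s : ℝ, s ^ 2 ≤ 2 → β s = s * (1 + (1 - s ^ 2) * (a + b * s ^ 2)) := by
    intro s hs
    rw [hβ, Real.smoothTransition.zero_of_nonpos (by linarith)]
    ring
  have hder : ∀ s : ℝ, s ^ 2 < 2 → deriv β s =
      (1 + (1 - s ^ 2) * (a + b * s ^ 2)) +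
        s * (-(2 * s) * (a + b * s ^ 2) + (1 - s ^ 2) * (b * (2 * s))) := by
    intro s hs
    have he : β =ᶠ[nhds s] fun s => s * (1 + (1 - s ^ 2) * (a + b * s ^ 2)) := by
      have : ∀ᶠ x : ℝ in nhds s, x ^ 2 < 2 :=
        (continuous_pow 2).continuousAt.eventually_lt continuousAt_const hs
      filter_upwards [this] with x hx using hlow x hx.le
    rw [he.deriv_eq]
    have h2 : HasDerivAt (fun x : ℝ => x ^ 2) (2 * s) s := by
      simpa using hasDerivAt_pow 2 s
    have h := (hasDerivAt_id' s).mul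
      (((h2.const_sub 1).mul ((h2.const_mul b).const_add a)).const_add 1)
    refine Eq.trans (HasDerivAt.deriv h) ?_
    simp only [Pi.mul_apply]
    ring
  refine ⟨2, by norm_num, β, ?_, ?_, ?_, ?_, ?_, ?_, ?_, ?_⟩
  · have hT : ContDiff ℝ (⊤ : ℕ∞) (fun s : ℝ => Real.smoothTransition (s ^ 2 - 2)) :=
      Real.smoothTransition.contDiff.comp (by fun_prop)
    show ContDiff ℝ (⊤ : ℕ∞) (fun s : ℝ => s * (1 + (Real.smoothTransition (s ^ 2 - 2) * (-(1 - l)) +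
      (1 - Real.smoothTransition (s ^ 2 - 2)) * ((1 - s ^ 2) * (a + b * s ^ 2)))))
    fun_prop
  · intro s
    simp only [hβ, neg_sq]
    ring
  · intro s
    constructor
    · intro h
      by_cases hs0 : s = 0
      · exact Or.inr (Or.inl hs0)
      have hq : 0 < a + b * s ^ 2 := by positivity
      have h1 : s ^ 2 = 1 := by
        rcases le_or_gt (s ^ 2) 2 with h2 | h2
        · rw [hlow s h2] at h
          have h3 : s * ((1 - s ^ 2) * (a + b * s ^ 2)) = 0 := by linarith
          rcases mul_eq_zero.1 h3 with h4 | h4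
          · exact absurd h4 hs0
          · rcases mul_eq_zero.1 h4 with h5 | h5
            · linarith
            · exact absurd h5 hq.ne'
        · exfalso
          rw [hβ] at h
          have hp := Real.smoothTransition.pos_of_pos (x := s ^ 2 - 2) (by linarith)
          have hle := Real.smoothTransition.le_one (s ^ 2 - 2)
          generalize Real.smoothTransition (s ^ 2 - 2) = T at *
          have h3 : s * (T * (-(1 - l)) + (1 - T) * ((1 - s ^ 2) * (a + b * s ^ 2))) = 0 := by
            linarith
          rcases mul_eq_zero.1 h3 with h4 | h4
          · exact hs0 h4
          · have h5 : 0 < T * (1 - l) := mul_pos hp (by linarith)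
            have h6 : 0 ≤ (1 - T) * ((s ^ 2 - 1) * (a + b * s ^ 2)) :=
              mul_nonneg (by linarith) (mul_nonneg (by linarith) hq.le)
            linarith
      rcases sq_eq_sq_iff_eq_or_eq_neg.1 (h1.trans (one_pow 2).symm) with h | h
      · exact Or.inr (Or.inr h)
      · exact Or.inl h
    · rintro (rfl | rfl | rfl)
      · rw [hlow _ (by norm_num)]; ring
      · rw [hlow _ (by norm_num)]; ring
      · rw [hlow _ (by norm_num)]; ring
  · rw [hder 0 (by norm_num)]; linarith
  · rw [hder 0 (by norm_num)]; linarith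
  · rw [hder (-1) (by norm_num), hb]; ring
  · rw [hder 1 (by norm_num), hb]; ring
  · intro s hs
    have : 4 < s ^ 2 := by
      rw [← sq_abs]; nlinarith
    rw [hβ, Real.smoothTransition.one_of_one_le (by linarith)]
    ring
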